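/- Let k be a field of characteristic p, A = k[y_1, …, y_d], A' = k[y_1^p, …, y_d^p] ⊆ A. Let θ ∈ M_r(A) be an r × r matrix over A with characteristic polynomial χ_θ(λ) ∈ A[λ]. Viewing multiplication by θ on A^r as an A'-linear endomorphism of the free A'-module A^r of rank p^d r, its characteristic polynomial over A' equals χ_θ(λ)^{p^d} (an element of A'[λ] after identifying coefficients). -/

import Mathlib

open Matrix Polynomial in
theorem Matrix.charpoly_comp_map {R S m n : Type*} [CommRing R] [CommRing S]
    [Fintype m] [DecidableEq m] [Fintype n] [DecidableEq n]
    (f : S →+* Matrix n n R) (M : Matrix m m S) :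
    ((M.map f).comp m m n n R).charpoly = (f.polyToMatrix M.charpoly).det := by
  rw [Matrix.charpoly, Matrix.charpoly, Matrix.det_det]
  congr 1
  ext ⟨i, a⟩ ⟨j, b⟩ : 2
  by_cases hij : i = j
  · subst hij
    by_cases hab : a = b
    · subst hab
      simp [RingHom.polyToMatrix, -AlgEquiv.symm_toRingEquiv]
    · simp [RingHom.polyToMatrix, -AlgEquiv.symm_toRingEquiv, hab]
  · simp [RingHom.polyToMatrix, -AlgEquiv.symm_toRingEquiv, hij]

theorem RingHom.polyToMatrix_algebraMap {R S n : Type*} [CommRing R] [CommRing S] [Algebra R S]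
    [Fintype n] [DecidableEq n] (f : S →ₐ[R] Matrix n n R) (c : Polynomial R) :
    (f : S →+* Matrix n n R).polyToMatrix (c.map (algebraMap R S)) = Matrix.scalar n c := by
  suffices h : ((f : S →+* Matrix n n R).polyToMatrix.comp
      (Polynomial.mapRingHom (algebraMap R S))) = Matrix.scalar n from DFunLike.congr_fun h c
  ext <;> simp [RingHom.polyToMatrix, -AlgEquiv.symm_toRingEquiv, Matrix.algebraMap_eq_diagonal,
      Matrix.diagonal_apply, apply_ite]

theorem Polynomial.exists_map_algebraMap_eq_pow {R S : Type*} [CommRing R] [CommRing S]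
    [Algebra R S] (p : ℕ) [ExpChar S p] (h : ∀ s : S, s ^ p ∈ (algebraMap R S).range)
    (g : Polynomial S) : ∃ c : Polynomial R, c.map (algebraMap R S) = g ^ p := by
  rw [← Polynomial.mem_lifts, ← Polynomial.map_frobenius_expand p g,
    Polynomial.lifts_iff_coeff_lifts]
  intro n
  rw [Polynomial.coeff_map]
  exact h _

theorem LinearMap.map_charpoly_restrictScalars_of_pow_mem {R S M ι : Type*} [CommRing R]
    [CommRing S] [IsDomain S] [Algebra R S] [AddCommGroup M] [Module R M] [Module S M]
    [IsScalarTower R S M] [Module.Free R M] [Module.Finite R M] [Module.Free S M]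
    [Module.Finite S M] [Fintype ι] (b : Module.Basis ι R S) (p : ℕ) [ExpChar S p]
    (h : ∀ s : S, s ^ p ∈ (algebraMap R S).range) (φ : M →ₗ[S] M) :
    (φ.restrictScalars R).charpoly.map (algebraMap R S) = φ.charpoly ^ Fintype.card ι := by
  classical
  let bM := Module.Free.chooseBasis S M
  obtain ⟨c, hc⟩ := Polynomial.exists_map_algebraMap_eq_pow (R := R) p h φ.charpoly
  refine frobenius_inj (Polynomial S) p ?_
  rw [_root_.frobenius_def, _root_.frobenius_def]
  rw [← LinearMap.charpoly_toMatrix _ (b.smulTower' bM), LinearMap.restrictScalars_toMatrix,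
    ← AlgHom.coe_toRingHom, Matrix.charpoly_comp_map, LinearMap.charpoly_toMatrix,
    ← Polynomial.map_pow, ← Matrix.det_pow, ← map_pow, ← hc, RingHom.polyToMatrix_algebraMap,
    ← pow_mul, mul_comm, pow_mul, ← hc]
  simp

theorem MvPolynomial.pow_expChar_mem_range_expand {σ R : Type*} [CommSemiring R] (p : ℕ)
    [ExpChar R p] (f : MvPolynomial σ R) :
    f ^ p ∈ (expand p : MvPolynomial σ R →ₐ[R] MvPolynomial σ R).range :=
  ⟨f.map (frobenius R p), by
    rw [← map_frobenius_expand p, map_expand]; rfl⟩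

namespace MvPolynomial

variable {σ R : Type*} [Fintype σ] [CommRing R] {p : ℕ} [NeZero p]

theorem coeff_expand_mul_monomial (g : MvPolynomial σ R) (a b : σ → Fin p) (m : σ →₀ ℕ) :
    coeff (p • m + Finsupp.equivFunOnFinite.symm fun i ↦ (a i : ℕ))
      (expand p g * monomial (Finsupp.equivFunOnFinite.symm fun i ↦ (b i : ℕ)) 1) =
      if b = a then coeff m g else 0 := by
  have hp : p ≠ 0 := NeZero.ne p
  split_ifs with h
  · subst h
    rw [coeff_mul_monomial, mul_one, coeff_expand_smul p hp]
  · rw [coeff_mul_monomial']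
    split_ifs with hle
    · obtain ⟨i, hi⟩ := Function.ne_iff.mp h
      rw [mul_one]
      refine coeff_expand_of_not_dvd _ (i := i) fun hdvd ↦ hi ?_
      have hlei := hle i
      simp only [Finsupp.coe_tsub, Finsupp.coe_add, Finsupp.coe_smul, Pi.sub_apply, Pi.add_apply,
        Pi.smul_apply, smul_eq_mul, Finsupp.equivFunOnFinite_symm_apply_apply] at hdvd hlei
      have h1 : (b i : ℕ) ≡ p * m i + a i [MOD p] := (Nat.modEq_iff_dvd' hlei).mpr hdvd
      have h2 : (b i : ℕ) ≡ a i [MOD p] := by simpa [Nat.ModEq] using h1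
      exact Fin.ext (h2.eq_of_lt_of_lt (b i).2 (a i).2)
    · rfl

variable (σ R p) in
/-- The monomials with all exponents less than `p` form a basis of `R[σ]` over the subalgebra
generated by the `p`-th powers of the variables. -/
noncomputable def basisOverExpandRange :
    Module.Basis (σ → Fin p) (expand p : MvPolynomial σ R →ₐ[R] MvPolynomial σ R).range
      (MvPolynomial σ R) :=
  Module.Basis.mk
    (v := fun b ↦ monomial (Finsupp.equivFunOnFinite.symm fun i ↦ (b i : ℕ)) (1 : R))
    (by
      classical
      rw [Fintype.linearIndependent_iff]
      intro g hg a
      choose q hq using fun b ↦ (g b).2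
      have : q a = 0 := by
        ext m
        have := congrArg (coeff (p • m + Finsupp.equivFunOnFinite.symm fun i ↦ (a i : ℕ))) hg
        simp only [Subalgebra.smul_def, smul_eq_mul, coeff_sum, coeff_zero, ← hq] at this
        simpa [-AlgHom.coe_toRingHom, coeff_expand_mul_monomial] using this
      ext1
      rw [← hq a, this]
      simp)
    (by
      rintro f -
      induction f using induction_on' with
      | add f g hf hg => exact add_mem hf hg
      | monomial m r =>
        have hp : 0 < p := NeZero.pos p
        let b : σ → Fin p := fun i ↦ ⟨m i % p, Nat.mod_lt _ hp⟩
        let q : σ →₀ ℕ := Finsupp.equivFunOnFinite.symm fun i ↦ m i / p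
        have : monomial m r = ((expand p : MvPolynomial σ R →ₐ[R] MvPolynomial σ R).rangeRestrict
            (monomial q r)) •
            monomial (Finsupp.equivFunOnFinite.symm fun i ↦ (b i : ℕ)) (1 : R) := by
          rw [Subalgebra.smul_def, smul_eq_mul, AlgHom.coe_codRestrict, expand_monomial,
            monomial_mul, mul_one]
          congr 2
          ext i
          simp [q, b, Nat.div_add_mod]
        rw [this]
        exact Submodule.smul_mem _ _ (Submodule.subset_span ⟨b, rfl⟩))

end MvPolynomial


/-- Frobenius pushforward multiplies characteristic polynomials by `p^d`: for
`A = k[y₁,…,y_d]` over a field `k` of characteristic `p`, `A' = k[y₁^p,…,y_d^p] ⊆ A`,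
and an `r × r` matrix `θ` over `A`, the characteristic polynomial of multiplication by
`θ` on `A^r`, viewed as an `A'`-linear endomorphism of the free `A'`-module `A^r` of
rank `p^d r`, equals `χ_θ ^ (p^d)` after identifying coefficients along `A' ⊆ A`. -/
theorem stmt11 (p : ℕ) [Fact p.Prime] (k : Type*) [Field k] [CharP k p]
    (d r : ℕ)
    (A' : Subalgebra k (MvPolynomial (Fin d) k))
    (hA' : A' = (MvPolynomial.expand p :
      MvPolynomial (Fin d) k →ₐ[k] MvPolynomial (Fin d) k).range)
    [Module.Free A' (Fin r → MvPolynomial (Fin d) k)]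
    [Module.Finite A' (Fin r → MvPolynomial (Fin d) k)]
    (θ : Matrix (Fin r) (Fin r) (MvPolynomial (Fin d) k)) :
    Polynomial.map (algebraMap A' (MvPolynomial (Fin d) k))
        (LinearMap.charpoly ((Matrix.mulVecLin θ).restrictScalars A'))
      = Matrix.charpoly θ ^ (p ^ d) := by
  subst hA'
  rw [LinearMap.map_charpoly_restrictScalars_of_pow_mem
    (MvPolynomial.basisOverExpandRange (Fin d) k p) p]
  · rw [← Matrix.toLin'_apply', Matrix.charpoly_toLin']
    simp
  · intro f
    obtain ⟨g, hg⟩ := MvPolynomial.pow_expChar_mem_range_expand p f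
    exact ⟨⟨_, g, rfl⟩, hg⟩
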